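/- Suppose m ≥ 3, x_3 = x_4 = ⋯ = x_n, ρ ≥ 0, M_{13} < 0 < M_{23}, and the hypotheses (i) x_1 ≤ x_2 ≤ min_{3≤i≤n} x_i, (ii) S + m·M_{12} ≥ −ρ, (iii) S + (m+1)·M_{12} < −(m+1)(m+n−1)·ρ hold. Then f(x_1, x_2, x_3, …, x_3) ≥ ((n−1)(n−2)/2)·[ M_{13}² + M_{23}² + (2(m+1)/((n−1)(n−2)))·M_{13}·M_{23} ]. -/

import Mathlib

open Finset

/-- `M x i j = x_i + x_j`. -/
noncomputable def solM (x : ℕ → ℝ) (i j : ℕ) : ℝ := x i + x j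

/-- `S = Σ_{i<j, {i,j}≠{1,2}} M_{ij}`, indices running over `1,…,n`. -/
noncomputable def solS (n : ℕ) (x : ℕ → ℝ) : ℝ :=
  ∑ i ∈ Icc 1 n, ∑ j ∈ Icc 1 n,
    if i < j ∧ ¬(i = 1 ∧ j = 2) then solM x i j else 0

/-- The function `f` from the algebra lemma. -/
noncomputable def solf (n m : ℕ) (x : ℕ → ℝ) : ℝ :=
  -(solS n x / ((m : ℝ) + 1)) * (solS n x + ((m : ℝ) + 1) * solM x 1 2)
    - solM x 1 2 * solS n x
    + ((∑ i ∈ Icc 1 n, ∑ j ∈ Icc 1 n,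
        if i < j ∧ ¬(i = 1 ∧ j = 2) then
          (solM x i j) ^ 2 +
            ∑ k ∈ (Icc 1 n).filter (fun k => k ≠ i ∧ k ≠ j), solM x i k * solM x j k
        else 0)
      + ((m : ℝ) + 1) *
          ∑ k ∈ (Icc 1 n).filter (fun k => k ≠ 1 ∧ k ≠ 2), solM x 1 k * solM x 2 k)

theorem sum_Icc_one_eq {n : ℕ} (hn : 2 ≤ n) (g : ℕ → ℝ) :
    ∑ k ∈ Icc 1 n, g k = g 1 + g 2 + ∑ k ∈ Icc 3 n, g k := by
  rw [← insert_Icc_add_one_left_eq_Icc (show 1 ≤ n by omega), sum_insert (by simp),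
    ← insert_Icc_add_one_left_eq_Icc (show 1 + 1 ≤ n by omega), sum_insert (by simp),
    ← add_assoc]
  rfl

theorem sum_Icc_eq_of_tail_const {n : ℕ} (hn : 2 ≤ n) {g : ℕ → ℝ} {c : ℝ}
    (hg : ∀ k, 3 ≤ k → k ≤ n → g k = c) :
    ∑ k ∈ Icc 1 n, g k = g 1 + g 2 + ((n : ℝ) - 2) * c := by
  have htail : ∑ k ∈ Icc 3 n, g k = ((n : ℝ) - 2) * c := by
    rw [sum_congr rfl fun k hk => hg k (mem_Icc.1 hk).1 (mem_Icc.1 hk).2, sum_const,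
      Nat.card_Icc, nsmul_eq_mul, Nat.cast_sub (by omega)]
    push_cast
    ring
  rw [sum_Icc_one_eq hn, htail]

theorem sum_Icc_ite_lt {n : ℕ} (hn : 2 ≤ n) (c : ℝ) :
    ∑ i ∈ Icc 3 n, ∑ j ∈ Icc 3 n, (if i < j then c else 0) =
      ((n : ℝ) - 2) * ((n : ℝ) - 3) / 2 * c := by
  induction n, hn using Nat.le_induction with
  | base => simp
  | succ n hn ih =>
    have hlast : ∀ i ∈ Icc 3 n, (if i < n + 1 then c else 0) = c := fun i hi =>
      if_pos (Nat.lt_succ_of_le (mem_Icc.1 hi).2)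
    have hrow : ∑ j ∈ Icc 3 (n + 1), (if n + 1 < j then c else 0) = 0 :=
      sum_eq_zero fun j hj => if_neg (mem_Icc.1 hj).2.not_gt
    rw [sum_Icc_succ_top (by omega), hrow]
    simp_rw [sum_Icc_succ_top (show 3 ≤ n + 1 by omega)]
    rw [sum_add_distrib, ih, sum_congr rfl hlast, sum_const, Nat.card_Icc, nsmul_eq_mul,
      Nat.cast_sub (by omega)]
    push_cast
    ring

theorem sum_pairs_eq {n : ℕ} (hn : 2 ≤ n) {F : ℕ → ℕ → ℝ} {α β γ : ℝ}
    (hα : ∀ j, 3 ≤ j → j ≤ n → F 1 j = α) (hβ : ∀ j, 3 ≤ j → j ≤ n → F 2 j = β)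
    (hγ : ∀ i j, 3 ≤ i → i < j → j ≤ n → F i j = γ) :
    (∑ i ∈ Icc 1 n, ∑ j ∈ Icc 1 n, if i < j ∧ ¬(i = 1 ∧ j = 2) then F i j else 0) =
      ((n : ℝ) - 2) * (α + β) + ((n : ℝ) - 2) * ((n : ℝ) - 3) / 2 * γ := by
  rw [sum_Icc_one_eq hn, sum_Icc_eq_of_tail_const hn (c := α),
    sum_Icc_eq_of_tail_const hn (c := β)]
  · have hrest : ∀ i ∈ Icc 3 n,
        (∑ j ∈ Icc 1 n, if i < j ∧ ¬(i = 1 ∧ j = 2) then F i j else 0) =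
          ∑ j ∈ Icc 3 n, if i < j then γ else 0 := by
      intro i hi
      have hi3 := (mem_Icc.1 hi).1
      rw [sum_Icc_one_eq hn, if_neg (by omega), if_neg (by omega), zero_add, zero_add]
      refine sum_congr rfl fun j hj => ?_
      by_cases hij : i < j
      · rw [if_pos ⟨hij, by omega⟩, if_pos hij, hγ i j hi3 hij (mem_Icc.1 hj).2]
      · rw [if_neg (by tauto), if_neg hij]
    rw [sum_congr rfl hrest, sum_Icc_ite_lt hn]
    simp
    ring
  · intro j hj hjn
    rw [if_pos (by omega), hβ j hj hjn]
  · intro j hj hjn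
    rw [if_pos (by omega), hα j hj hjn]

theorem sum_filter_ne_ne {n i j : ℕ} (hi : i ∈ Icc 1 n) (hj : j ∈ Icc 1 n) (hij : i ≠ j)
    (g : ℕ → ℝ) :
    ∑ k ∈ (Icc 1 n).filter (fun k => k ≠ i ∧ k ≠ j), g k =
      ∑ k ∈ Icc 1 n, g k - g i - g j := by
  have hset : (Icc 1 n).filter (fun k => k ≠ i ∧ k ≠ j) = ((Icc 1 n).erase i).erase j := by
    ext k
    simp only [mem_filter, mem_erase]
    tauto
  rw [hset, sum_erase_eq_sub (mem_erase.2 ⟨hij.symm, hj⟩), sum_erase_eq_sub hi]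

theorem solS_eq {n : ℕ} (hn : 2 ≤ n) {x : ℕ → ℝ} (hx : ∀ i, 3 ≤ i → i ≤ n → x i = x 3) :
    solS n x = ((n : ℝ) - 2) * (x 1 + x 2 + 2 * x 3) +
      ((n : ℝ) - 2) * ((n : ℝ) - 3) * x 3 := by
  unfold solS solM
  rw [sum_pairs_eq hn (α := x 1 + x 3) (β := x 2 + x 3) (γ := 2 * x 3)]
  · ring
  · intro j hj hjn
    rw [hx j hj hjn]
  · intro j hj hjn
    rw [hx j hj hjn]
  · intro i j hi hij hjn
    rw [hx i hi (by omega), hx j (by omega) hjn]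
    ring

theorem sum_filter_solM_mul_solM {n i j : ℕ} (hn : 2 ≤ n) {x : ℕ → ℝ}
    (hx : ∀ i, 3 ≤ i → i ≤ n → x i = x 3) (hi : i ∈ Icc 1 n) (hj : j ∈ Icc 1 n)
    (hij : i ≠ j) :
    ∑ k ∈ (Icc 1 n).filter (fun k => k ≠ i ∧ k ≠ j), solM x i k * solM x j k =
      (x i + x 1) * (x j + x 1) + (x i + x 2) * (x j + x 2) +
        ((n : ℝ) - 2) * ((x i + x 3) * (x j + x 3)) -
        2 * x i * (x j + x i) - (x i + x j) * (2 * x j) := by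
  rw [sum_filter_ne_ne hi hj hij,
    sum_Icc_eq_of_tail_const hn (c := (x i + x 3) * (x j + x 3))]
  · unfold solM
    ring
  · intro k hk hkn
    simp only [solM, hx k hk hkn]

theorem solf_eq {n : ℕ} (m : ℕ) (hn : 2 ≤ n) {x : ℕ → ℝ}
    (hx : ∀ i, 3 ≤ i → i ≤ n → x i = x 3) :
    solf n m x =
      -(solS n x / ((m : ℝ) + 1)) * (solS n x + ((m : ℝ) + 1) * solM x 1 2)
        - solM x 1 2 * solS n x
        + ((n : ℝ) - 2) * (solM x 1 3 ^ 2 + solM x 2 3 ^ 2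
            + solM x 1 2 * (solM x 1 3 + solM x 2 3)
            + 2 * ((n : ℝ) - 3) * x 3 * (solM x 1 3 + solM x 2 3))
        + ((n : ℝ) - 2) * ((n : ℝ) - 3) / 2 *
            (solM x 1 3 ^ 2 + solM x 2 3 ^ 2 + 4 * ((n : ℝ) - 3) * x 3 ^ 2)
        + ((m : ℝ) + 1) * ((n : ℝ) - 2) * (solM x 1 3 * solM x 2 3) := by
  have hmem : ∀ {k}, 1 ≤ k → k ≤ n → k ∈ Icc 1 n := fun h h' => mem_Icc.2 ⟨h, h'⟩
  unfold solf
  rw [sum_filter_solM_mul_solM hn hx (hmem le_rfl (by omega)) (hmem (by norm_num) (by omega))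
      (by norm_num),
    sum_pairs_eq hn
      (α := solM x 1 3 ^ 2 + solM x 1 2 * solM x 2 3 +
        2 * ((n : ℝ) - 3) * x 3 * solM x 1 3)
      (β := solM x 2 3 ^ 2 + solM x 1 2 * solM x 1 3 +
        2 * ((n : ℝ) - 3) * x 3 * solM x 2 3)
      (γ := solM x 1 3 ^ 2 + solM x 2 3 ^ 2 + 4 * ((n : ℝ) - 3) * x 3 ^ 2)]
  · unfold solM
    ring
  · intro j hj hjn
    rw [sum_filter_solM_mul_solM hn hx (hmem le_rfl (by omega)) (hmem (by omega) hjn)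
      (by omega)]
    simp only [solM, hx j hj hjn]
    ring
  · intro j hj hjn
    rw [sum_filter_solM_mul_solM hn hx (hmem (by omega) (by omega)) (hmem (by omega) hjn)
      (by omega)]
    simp only [solM, hx j hj hjn]
    ring
  · intro i j hi hij hjn
    rw [sum_filter_solM_mul_solM hn hx (hmem (by omega) (by omega)) (hmem (by omega) hjn)
      (by omega)]
    simp only [solM, hx j (by omega) hjn, hx i hi (by omega)]
    ring

/-- With `N = n - 2`, `q = m + 1`, `μ = -M₁₂` and `δ = q μ - S`, this is the estimate that
remains after substituting `x₃ = (S + N μ) / (N (N + 1))`. -/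
theorem quadratic_form_nonneg {N q μ δ ρ : ℝ} (hN : 2 ≤ N) (hq : 4 ≤ q)
    (hρ : 0 ≤ ρ) (hδ : δ ≤ μ + ρ) (hρδ : q * (q + N) * ρ < δ) :
    0 ≤ (q + N) * (N - 1) * μ * (N * μ - 2 * δ) + 2 * N * μ * δ + 2 * (N - 1) * δ ^ 2 -
      N * (N + 1) * δ ^ 2 / q := by
  have hδ0 : 0 < δ := lt_of_le_of_lt (by positivity) hρδ
  have hA : 4 * ((q + N) * ρ) ≤ δ := by
    have : 0 ≤ (q - 4) * ((q + N) * ρ) := mul_nonneg (by linarith) (by positivity)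
    linarith
  have hρs : 24 * ρ ≤ δ := by nlinarith
  have hμ : 23 / 24 * δ ≤ μ := by linarith
  have hμ0 : 0 < μ := by linarith
  have hdiv : N * (N + 1) * δ ^ 2 / q ≤ N * (N + 1) * δ ^ 2 / 4 := by gcongr
  have hlin : 0 ≤ (q + N) * ((N - 1) * μ) * (μ + ρ - δ) :=
    mul_nonneg (mul_nonneg (by linarith) (mul_nonneg (by linarith) hμ0.le)) (by linarith)
  have hrho : 0 ≤ ((N - 1) * μ) * (δ - 4 * ((q + N) * ρ)) :=
    mul_nonneg (mul_nonneg (by linarith) hμ0.le) (by linarith)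
  have hμδ : 23 / 24 * δ ^ 2 ≤ μ * δ := by nlinarith
  have hμμ : 9 / 10 * δ ^ 2 ≤ μ ^ 2 := by nlinarith
  have hquad : (N + 4) * ((N - 1) * (N - 2)) * (9 / 10 * δ ^ 2) ≤
      (q + N) * ((N - 1) * (N - 2)) * μ ^ 2 := by
    have : 0 ≤ (N - 1) * (N - 2) := mul_nonneg (by linarith) (by linarith)
    gcongr ?_ * _ * ?_
    linarith
  have hmix : (2 * N - (N - 1) / 2) * (23 / 24 * δ ^ 2) ≤ (2 * N - (N - 1) / 2) * (μ * δ) :=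
    mul_le_mul_of_nonneg_left hμδ (by linarith)
  have hcoef : 0 ≤ (N + 4) * ((N - 1) * (N - 2)) * (9 / 10) +
      (2 * N - (N - 1) / 2) * (23 / 24) + 2 * (N - 1) - N * (N + 1) / 4 := by
    nlinarith [mul_nonneg (mul_nonneg (sub_nonneg.2 hN) (sub_nonneg.2 hN)) (sub_nonneg.2 hN),
      mul_nonneg (sub_nonneg.2 hN) (sub_nonneg.2 hN)]
  have := mul_nonneg hcoef (sq_nonneg δ)
  nlinarith

/-- Case 2 of the algebra lemma: the key lower bound for `f` when `m ≥ 3` and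
`M_{13} < 0 < M_{23}`. -/
theorem case_m_ge_three (n m : ℕ) (hn : 4 ≤ n) (hm : 3 ≤ m) (ρ : ℝ) (hρ : 0 ≤ ρ)
    (x : ℕ → ℝ)
    (hx : ∀ i, 3 ≤ i → i ≤ n → x i = x 3)
    (hM13 : solM x 1 3 < 0) (hM23 : 0 < solM x 2 3)
    (h1 : x 1 ≤ x 2 ∧ ∀ i, 3 ≤ i → i ≤ n → x 2 ≤ x i)
    (h2 : solS n x + (m : ℝ) * solM x 1 2 ≥ -ρ)
    (h3 : solS n x + ((m : ℝ) + 1) * solM x 1 2 <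
      -(((m : ℝ) + 1) * ((m : ℝ) + (n : ℝ) - 1)) * ρ) :
    solf n m x ≥
      ((n : ℝ) - 1) * ((n : ℝ) - 2) / 2 *
        ((solM x 1 3) ^ 2 + (solM x 2 3) ^ 2
          + 2 * ((m : ℝ) + 1) / (((n : ℝ) - 1) * ((n : ℝ) - 2)) *
              solM x 1 3 * solM x 2 3) := by
  have hn' : (4 : ℝ) ≤ n := by exact_mod_cast hn
  have hm' : (3 : ℝ) ≤ m := by exact_mod_cast hm
  have hS := solS_eq (by omega) hx
  have hb : x 2 ≤ x 3 := h1.2 3 le_rfl (by omega)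
  have hf := solf_eq m (by omega) hx
  have hM12 : solM x 1 2 = solM x 1 3 + solM x 2 3 - 2 * x 3 := by unfold solM; ring
  have hq3 : solM x 2 3 ≤ 2 * x 3 := by unfold solM; linarith
  have hS' : solS n x = ((n : ℝ) - 2) * (solM x 1 3 + solM x 2 3) +
      ((n : ℝ) - 2) * ((n : ℝ) - 3) * x 3 := by rw [hS]; unfold solM; ring
  rw [hf]
  clear hf hS hx h1
  generalize solS n x = S at *
  generalize solM x 1 2 = M at *
  generalize solM x 1 3 = p at *
  generalize solM x 2 3 = r at *
  generalize x 3 = c at *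
  obtain ⟨N, hN⟩ : ∃ N : ℝ, (n : ℝ) = N + 2 := ⟨n - 2, by ring⟩
  obtain ⟨q, hq⟩ : ∃ q : ℝ, (m : ℝ) = q - 1 := ⟨m + 1, by ring⟩
  rw [hN] at hn' h3 hS' ⊢
  rw [hq] at hm' h2 h3 ⊢
  have hq0 : 0 < q := by linarith
  have hN2 : 2 ≤ N := by linarith
  have hquad := quadratic_form_nonneg (N := N) (q := q) (μ := -M) (δ := q * (-M) - S) (ρ := ρ)
    hN2 (by linarith) hρ (by linarith) (by linarith)
  have hpr : 2 * c * M ≤ p * r := by nlinarith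
  have hcross := mul_le_mul_of_nonneg_left hpr
    (mul_nonneg hq0.le (by linarith : (0 : ℝ) ≤ N - 1))
  have hD : 0 < N * (N + 1) := by positivity
  have hreduced : 0 ≤ -S ^ 2 / q - 2 * M * S + N * M * (p + r) + 2 * N * (N - 1) * c * (p + r) +
      2 * N * (N - 1) ^ 2 * c ^ 2 + q * (N - 1) * (2 * c * M) := by
    refine nonneg_of_mul_nonneg_right (hquad.trans_eq ?_) hD
    have hs : p + r = M + 2 * c := by linarith
    rw [hS', hs]
    field_simp
    ring
  have hrhs : (N + 2 - 1) * (N + 2 - 2) / 2 * (p ^ 2 + r ^ 2 +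
      2 * (q - 1 + 1) / ((N + 2 - 1) * (N + 2 - 2)) * p * r) =
      N * (N + 1) / 2 * (p ^ 2 + r ^ 2) + q * (p * r) := by
    have h₁ : N + 2 - 1 ≠ 0 := by linarith
    have h₂ : N + 2 - 2 ≠ 0 := by linarith
    field_simp
    ring
  rw [hrhs, sub_add_cancel]
  have hsq : -(S / q) * (S + q * M) = -S ^ 2 / q - M * S := by
    field_simp
    ring
  rw [hsq]
  linarith
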